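/- Let (A,β_A) and (B,β_B) be braided Hopf algebras over a field k. Then the bilinear form δ on the tensor product Hopf algebra A ⊗ B defined by δ(a ⊗ b, a' ⊗ b') = β_A(a,a') β_B(b,b') is a braiding on A ⊗ B. -/

import Mathlib

/-!
STATEMENT 15: Let (A,β_A) and (B,β_B) be braided Hopf algebras over a field k.  Then
δ(a⊗b, a'⊗b') = β_A(a,a') β_B(b,b') is a braiding on the tensor product Hopf algebra A ⊗ B.
-/

open TensorProduct Coalgebra LinearMap

noncomputable section

variable {k : Type} [Field k]

/-- Convolution product of linear maps from a coalgebra `C` to an algebra `M`: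
`(f * g)(c) = Σ f(c₁) g(c₂)`. -/
def conv {C M : Type} [AddCommGroup C] [Module k C] [Coalgebra k C]
    [Ring M] [Algebra k M] (f g : C →ₗ[k] M) : C →ₗ[k] M :=
  (LinearMap.mul' k M) ∘ₗ (TensorProduct.map f g) ∘ₗ Coalgebra.comul

/-- `Σ g(c₁) • f(c₂)`. -/
def convL {C M : Type} [AddCommGroup C] [Module k C] [Coalgebra k C]
    [AddCommGroup M] [Module k M] (g : C →ₗ[k] k) (f : C →ₗ[k] M) : C →ₗ[k] M :=
  (TensorProduct.lid k M).toLinearMap ∘ₗ (TensorProduct.map g f) ∘ₗ Coalgebra.comul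

/-- `Σ g(c₂) • f(c₁)`. -/
def convR {C M : Type} [AddCommGroup C] [Module k C] [Coalgebra k C]
    [AddCommGroup M] [Module k M] (f : C →ₗ[k] M) (g : C →ₗ[k] k) : C →ₗ[k] M :=
  (TensorProduct.rid k M).toLinearMap ∘ₗ (TensorProduct.map f g) ∘ₗ Coalgebra.comul

/-- Convolution invertibility of a bilinear form. -/
def IsConvInvertible {C : Type} [AddCommGroup C] [Module k C] [Coalgebra k C]
    (τ : C →ₗ[k] k) : Prop :=
  ∃ τi : C →ₗ[k] k, conv τ τi = Coalgebra.counit ∧ conv τi τ = Coalgebra.counit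

/-- A skew pairing on the ordered pair `(A, U)` (stated for algebra-coalgebras, so that it
applies in particular to tensor products of Hopf algebras). -/
structure IsSkewPairing {A U : Type} [Ring A] [Ring U] [Algebra k A] [Algebra k U]
    [Coalgebra k A] [Coalgebra k U] (τ : A ⊗[k] U →ₗ[k] k) : Prop where
  mul_left : ∀ (b c : A) (u : U),
    τ ((b * c) ⊗ₜ u) = conv (τ ∘ₗ TensorProduct.mk k A U b) (τ ∘ₗ TensorProduct.mk k A U c) u
  mul_right : ∀ (b : A) (u v : U),
    τ (b ⊗ₜ (u * v)) =
      conv (τ ∘ₗ (TensorProduct.mk k A U).flip v) (τ ∘ₗ (TensorProduct.mk k A U).flip u) b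
  one_left : ∀ u : U, τ (1 ⊗ₜ u) = Coalgebra.counit u
  one_right : ∀ a : A, τ (a ⊗ₜ 1) = Coalgebra.counit a

/-- A braiding on a Hopf algebra (stated for algebra-coalgebras) `A`. -/
structure IsBraiding {A : Type} [Ring A] [Algebra k A] [Coalgebra k A]
    (β : A ⊗[k] A →ₗ[k] k) : Prop where
  skew : IsSkewPairing β
  invertible : IsConvInvertible β
  compat : ∀ a b : A,
    convR ((LinearMap.mul' k A) ∘ₗ (TensorProduct.comm k A A).toLinearMap) β (a ⊗ₜ b)
      = convL β (LinearMap.mul' k A) (a ⊗ₜ b)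

/-- The linear form `c ⊗ d ↦ f c * g d`. -/
def tensorForm {C D : Type} [AddCommGroup C] [Module k C] [AddCommGroup D] [Module k D]
    (f : C →ₗ[k] k) (g : D →ₗ[k] k) : C ⊗[k] D →ₗ[k] k :=
  LinearMap.mul' k k ∘ₗ TensorProduct.map f g

@[simp]
theorem tensorForm_tmul {C D : Type} [AddCommGroup C] [Module k C] [AddCommGroup D] [Module k D]
    (f : C →ₗ[k] k) (g : D →ₗ[k] k) (c : C) (d : D) :
    tensorForm f g (c ⊗ₜ d) = f c * g d := rfl

section Coalgebra

variable {C D : Type} [AddCommGroup C] [Module k C] [Coalgebra k C]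
  [AddCommGroup D] [Module k D] [Coalgebra k D]

theorem conv_tensorForm (f g : C →ₗ[k] k) (f' g' : D →ₗ[k] k) :
    conv (tensorForm f f') (tensorForm g g') = tensorForm (conv f g) (conv f' g') := by
  ext c d
  simp only [conv, AlgebraTensorModule.curry_apply, curry_apply, coe_restrictScalars, coe_comp,
    Function.comp_apply, TensorProduct.comul_tmul, tensorForm_tmul]
  generalize comul (R := k) c = x
  generalize comul (R := k) d = y
  induction x with
  | zero => simp
  | add x₁ x₂ h₁ h₂ => simp only [add_tmul, map_add, h₁, h₂, add_mul]
  | tmul c₁ c₂ =>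
    induction y with
    | zero => simp
    | add y₁ y₂ h₁ h₂ => simp only [tmul_add, map_add, h₁, h₂, mul_add]
    | tmul d₁ d₂ => simp; ring

theorem convL_tensorForm {M N : Type} [AddCommGroup M] [Module k M] [AddCommGroup N] [Module k N]
    (g : C →ₗ[k] k) (g' : D →ₗ[k] k) (f : C →ₗ[k] M) (f' : D →ₗ[k] N) :
    convL (tensorForm g g') (TensorProduct.map f f') =
      TensorProduct.map (convL g f) (convL g' f') := by
  ext c d
  simp only [convL, AlgebraTensorModule.curry_apply, curry_apply, coe_restrictScalars, coe_comp,
    Function.comp_apply, TensorProduct.comul_tmul, map_tmul]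
  generalize comul (R := k) c = x
  generalize comul (R := k) d = y
  induction x with
  | zero => simp
  | add x₁ x₂ h₁ h₂ => simp only [add_tmul, map_add, h₁, h₂]
  | tmul c₁ c₂ =>
    induction y with
    | zero => simp
    | add y₁ y₂ h₁ h₂ => simp only [tmul_add, map_add, h₁, h₂]
    | tmul d₁ d₂ => simp [smul_tmul', smul_smul, mul_comm]

theorem convR_tensorForm {M N : Type} [AddCommGroup M] [Module k M] [AddCommGroup N] [Module k N]
    (g : C →ₗ[k] k) (g' : D →ₗ[k] k) (f : C →ₗ[k] M) (f' : D →ₗ[k] N) :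
    convR (TensorProduct.map f f') (tensorForm g g') =
      TensorProduct.map (convR f g) (convR f' g') := by
  ext c d
  simp only [convR, AlgebraTensorModule.curry_apply, curry_apply, coe_restrictScalars, coe_comp,
    Function.comp_apply, TensorProduct.comul_tmul, map_tmul]
  generalize comul (R := k) c = x
  generalize comul (R := k) d = y
  induction x with
  | zero => simp
  | add x₁ x₂ h₁ h₂ => simp only [add_tmul, map_add, h₁, h₂]
  | tmul c₁ c₂ =>
    induction y with
    | zero => simp
    | add y₁ y₂ h₁ h₂ => simp only [tmul_add, map_add, h₁, h₂]
    | tmul d₁ d₂ => simp [smul_tmul', smul_smul, mul_comm]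

theorem tensorForm_counit :
    tensorForm (counit (R := k) (A := C)) (counit (R := k) (A := D)) = counit := by
  ext c d
  simp [mul_comm]

theorem conv_comp {f g : D →ₗ[k] k} {φ : C →ₗ[k] D}
    (hφ : comul ∘ₗ φ = TensorProduct.map φ φ ∘ₗ comul) :
    conv (f ∘ₗ φ) (g ∘ₗ φ) = conv f g ∘ₗ φ := by
  simp only [conv, comp_assoc, hφ, TensorProduct.map_comp]

theorem convL_comp {M : Type} [AddCommGroup M] [Module k M]
    {g : D →ₗ[k] k} {f : D →ₗ[k] M} {φ : C →ₗ[k] D}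
    (hφ : comul ∘ₗ φ = TensorProduct.map φ φ ∘ₗ comul) :
    convL (g ∘ₗ φ) (f ∘ₗ φ) = convL g f ∘ₗ φ := by
  simp only [convL, comp_assoc, hφ, TensorProduct.map_comp]

theorem convR_comp {M : Type} [AddCommGroup M] [Module k M]
    {g : D →ₗ[k] k} {f : D →ₗ[k] M} {φ : C →ₗ[k] D}
    (hφ : comul ∘ₗ φ = TensorProduct.map φ φ ∘ₗ comul) :
    convR (f ∘ₗ φ) (g ∘ₗ φ) = convR f g ∘ₗ φ := by
  simp only [convR, comp_assoc, hφ, TensorProduct.map_comp]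

/-- The middle-four interchange is comultiplicative. -/
theorem comul_comp_tensorTensorTensorComm :
    comul ∘ₗ (TensorProduct.tensorTensorTensorComm k C D C D).toLinearMap =
      TensorProduct.map (TensorProduct.tensorTensorTensorComm k C D C D).toLinearMap
        (TensorProduct.tensorTensorTensorComm k C D C D).toLinearMap ∘ₗ comul := by
  ext a b c d
  simp only [AlgebraTensorModule.curry_apply, curry_apply, coe_restrictScalars, coe_comp,
    LinearEquiv.coe_coe, Function.comp_apply, TensorProduct.comul_tmul, tensorTensorTensorComm_tmul]
  generalize comul (R := k) a = x
  generalize comul (R := k) b = y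
  generalize comul (R := k) c = z
  generalize comul (R := k) d = w
  induction x with
  | zero => simp
  | add x₁ x₂ h₁ h₂ => simp only [add_tmul, map_add, h₁, h₂]
  | tmul a₁ a₂ =>
  induction y with
  | zero => simp
  | add x₁ x₂ h₁ h₂ => simp only [add_tmul, tmul_add, map_add, h₁, h₂]
  | tmul b₁ b₂ =>
  induction z with
  | zero => simp
  | add x₁ x₂ h₁ h₂ => simp only [add_tmul, tmul_add, map_add, h₁, h₂]
  | tmul c₁ c₂ =>
  induction w with
  | zero => simp
  | add x₁ x₂ h₁ h₂ => simp only [tmul_add, map_add, h₁, h₂]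
  | tmul d₁ d₂ => simp

theorem counit_comp_tensorTensorTensorComm :
    counit ∘ₗ (TensorProduct.tensorTensorTensorComm k C D C D).toLinearMap =
      (counit : (C ⊗[k] D) ⊗[k] (C ⊗[k] D) →ₗ[k] k) := by
  ext a b c d
  simp
  ring

end Coalgebra

theorem conv_add_left {C : Type} [AddCommGroup C] [Module k C] [Coalgebra k C]
    (f g h : C →ₗ[k] k) : conv (f + g) h = conv f h + conv g h := by
  simp only [conv, TensorProduct.map_add_left, add_comp, comp_add]

theorem conv_add_right {C : Type} [AddCommGroup C] [Module k C] [Coalgebra k C]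
    (f g h : C →ₗ[k] k) : conv f (g + h) = conv f g + conv f h := by
  simp only [conv, TensorProduct.map_add_right, add_comp, comp_add]

theorem conv_zero_left {C : Type} [AddCommGroup C] [Module k C] [Coalgebra k C]
    (h : C →ₗ[k] k) : conv 0 h = 0 := by
  simp only [conv, TensorProduct.map_zero_left, zero_comp, comp_zero]

theorem conv_zero_right {C : Type} [AddCommGroup C] [Module k C] [Coalgebra k C]
    (h : C →ₗ[k] k) : conv h 0 = 0 := by
  simp only [conv, TensorProduct.map_zero_right, zero_comp, comp_zero]

variable {A B : Type} [Ring A] [Ring B] [HopfAlgebra k A] [HopfAlgebra k B]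

/-- The form `δ(a ⊗ b, a' ⊗ b') = β_A(a, a') β_B(b, b')`. -/
def tensorPairing (βA : A ⊗[k] A →ₗ[k] k) (βB : B ⊗[k] B →ₗ[k] k) :
    (A ⊗[k] B) ⊗[k] (A ⊗[k] B) →ₗ[k] k :=
  tensorForm βA βB ∘ₗ (TensorProduct.tensorTensorTensorComm k A B A B).toLinearMap

theorem tensorPairing_comp_mk (βA : A ⊗[k] A →ₗ[k] k) (βB : B ⊗[k] B →ₗ[k] k) (a : A) (b : B) :
    tensorPairing βA βB ∘ₗ TensorProduct.mk k _ _ (a ⊗ₜ b) =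
      tensorForm (βA ∘ₗ TensorProduct.mk k A A a) (βB ∘ₗ TensorProduct.mk k B B b) := by
  ext
  simp [tensorPairing]

theorem tensorPairing_comp_mk_flip (βA : A ⊗[k] A →ₗ[k] k) (βB : B ⊗[k] B →ₗ[k] k)
    (a : A) (b : B) :
    tensorPairing βA βB ∘ₗ (TensorProduct.mk k _ _).flip (a ⊗ₜ b) =
      tensorForm (βA ∘ₗ (TensorProduct.mk k A A).flip a)
        (βB ∘ₗ (TensorProduct.mk k B B).flip b) := by
  ext
  simp [tensorPairing]

theorem IsSkewPairing.tensorPairing {βA : A ⊗[k] A →ₗ[k] k} (hA : IsSkewPairing βA)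
    {βB : B ⊗[k] B →ₗ[k] k} (hB : IsSkewPairing βB) : IsSkewPairing (tensorPairing βA βB) where
  mul_left x y u := by
    change (_root_.tensorPairing βA βB ∘ₗ TensorProduct.mk k _ _ (x * y)) u = _
    refine LinearMap.congr_fun ?_ u
    induction x with
    | zero => simp [conv_zero_left]
    | add x₁ x₂ h₁ h₂ => simp only [add_mul, map_add, comp_add, conv_add_left, h₁, h₂]
    | tmul a b =>
    induction y with
    | zero => simp [conv_zero_right]
    | add y₁ y₂ h₁ h₂ => simp only [mul_add, map_add, comp_add, conv_add_right, h₁, h₂]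
    | tmul c d =>
      rw [Algebra.TensorProduct.tmul_mul_tmul]
      simp only [tensorPairing_comp_mk, conv_tensorForm]
      congr 1
      · ext u; exact hA.mul_left a c u
      · ext u; exact hB.mul_left b d u
  mul_right x u v := by
    change (_root_.tensorPairing βA βB ∘ₗ (TensorProduct.mk k _ _).flip (u * v)) x = _
    refine LinearMap.congr_fun ?_ x
    induction u with
    | zero => simp [conv_zero_right]
    | add x₁ x₂ h₁ h₂ => simp only [add_mul, map_add, comp_add, conv_add_right, h₁, h₂]
    | tmul a b =>
    induction v with
    | zero => simp [conv_zero_left]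
    | add y₁ y₂ h₁ h₂ => simp only [mul_add, map_add, comp_add, conv_add_left, h₁, h₂]
    | tmul c d =>
      rw [Algebra.TensorProduct.tmul_mul_tmul]
      simp only [tensorPairing_comp_mk_flip, conv_tensorForm]
      congr 1
      · ext u; exact hA.mul_right u a c
      · ext u; exact hB.mul_right u b d
  one_left u := by
    change (_root_.tensorPairing βA βB ∘ₗ TensorProduct.mk k _ _ (1 ⊗ₜ 1)) u = _
    rw [tensorPairing_comp_mk, ← tensorForm_counit]
    congr 2
    · ext u; exact hA.one_left u
    · ext u; exact hB.one_left u
  one_right u := by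
    change (_root_.tensorPairing βA βB ∘ₗ (TensorProduct.mk k _ _).flip (1 ⊗ₜ 1)) u = _
    rw [tensorPairing_comp_mk_flip, ← tensorForm_counit]
    congr 2
    · ext u; exact hA.one_right u
    · ext u; exact hB.one_right u

theorem conv_tensorPairing {f g : A ⊗[k] A →ₗ[k] k} {f' g' : B ⊗[k] B →ₗ[k] k}
    (h : conv f g = counit) (h' : conv f' g' = counit) :
    conv (tensorPairing f f') (tensorPairing g g') = counit := by
  rw [tensorPairing, tensorPairing, conv_comp comul_comp_tensorTensorTensorComm, conv_tensorForm,
    h, h', tensorForm_counit, counit_comp_tensorTensorTensorComm]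

theorem IsConvInvertible.tensorPairing {βA : A ⊗[k] A →ₗ[k] k} (hA : IsConvInvertible βA)
    {βB : B ⊗[k] B →ₗ[k] k} (hB : IsConvInvertible βB) :
    IsConvInvertible (tensorPairing βA βB) := by
  obtain ⟨γA, hA₁, hA₂⟩ := hA
  obtain ⟨γB, hB₁, hB₂⟩ := hB
  exact ⟨_root_.tensorPairing γA γB, conv_tensorPairing hA₁ hB₁, conv_tensorPairing hA₂ hB₂⟩

theorem mul'_tensorProduct :
    LinearMap.mul' k (A ⊗[k] B) =
      TensorProduct.map (LinearMap.mul' k A) (LinearMap.mul' k B) ∘ₗ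
        (TensorProduct.tensorTensorTensorComm k A B A B).toLinearMap := by
  ext
  simp

theorem mul'_comp_comm_tensorProduct :
    LinearMap.mul' k (A ⊗[k] B) ∘ₗ (TensorProduct.comm k _ _).toLinearMap =
      TensorProduct.map (LinearMap.mul' k A ∘ₗ (TensorProduct.comm k A A).toLinearMap)
          (LinearMap.mul' k B ∘ₗ (TensorProduct.comm k B B).toLinearMap) ∘ₗ
        (TensorProduct.tensorTensorTensorComm k A B A B).toLinearMap := by
  ext
  simp

theorem IsBraiding.tensorPairing {βA : A ⊗[k] A →ₗ[k] k} (hA : IsBraiding βA)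
    {βB : B ⊗[k] B →ₗ[k] k} (hB : IsBraiding βB) : IsBraiding (tensorPairing βA βB) where
  skew := hA.skew.tensorPairing hB.skew
  invertible := hA.invertible.tensorPairing hB.invertible
  compat x y := by
    refine LinearMap.congr_fun ?_ (x ⊗ₜ y)
    rw [mul'_comp_comm_tensorProduct, mul'_tensorProduct, _root_.tensorPairing,
      convR_comp comul_comp_tensorTensorTensorComm, convL_comp comul_comp_tensorTensorTensorComm,
      convR_tensorForm, convL_tensorForm, TensorProduct.ext' hA.compat,
      TensorProduct.ext' hB.compat]

/-- `δ(a⊗b, a'⊗b') = β_A(a,a') β_B(b,b')` is a braiding on `A ⊗ B`. -/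
theorem tensor_braiding (βA : A ⊗[k] A →ₗ[k] k) (hA : IsBraiding βA)
    (βB : B ⊗[k] B →ₗ[k] k) (hB : IsBraiding βB) :
    IsBraiding
      ((LinearMap.mul' k k) ∘ₗ TensorProduct.map βA βB ∘ₗ
        (TensorProduct.tensorTensorTensorComm k A B A B).toLinearMap
        : (A ⊗[k] B) ⊗[k] (A ⊗[k] B) →ₗ[k] k) := by
  exact hA.tensorPairing hB

end
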